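/- Fix a natural number d and a real polynomial P ∈ ℝ[x]. There exist phases φ₀, …, φ_d ∈ ℝ such that for all a ∈ [−1,1] the complex number (1/2)·(M₀₀ + M₀₁ + M₁₀ + M₁₁) equals P(a), where M := S(φ₀) · ∏_{k=1}^{d} ( W(a) · S(φ_k) ) (this is the matrix element ⟨+|M|+⟩), if and only if: (i) deg P ≤ d; (ii) P(−x) = (−1)^d P(x); (iii) |P(a)| ≤ 1 for all a ∈ [−1,1]. -/

import Mathlib

open Matrix Polynomial

/-- The QSP signal rotation operator `W(a)`. -/
noncomputable def Wmat (a : ℝ) : Matrix (Fin 2) (Fin 2) ℂ :=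
  !![(a : ℂ), Complex.I * Real.sqrt (1 - a ^ 2);
     Complex.I * Real.sqrt (1 - a ^ 2), (a : ℂ)]

/-- The QSP signal processing operator `S(φ) = e^{iφZ}`. -/
noncomputable def Smat (φ : ℝ) : Matrix (Fin 2) (Fin 2) ℂ :=
  !![Complex.exp (Complex.I * φ), 0; 0, Complex.exp (-(Complex.I * φ))]

/-- The QSP sequence `S(φ₀) ∏_{k=1}^d (W(a) S(φ_k))`, product ordered with increasing `k`. -/
noncomputable def qspSeq (d : ℕ) (φ : ℕ → ℝ) (a : ℝ) : Matrix (Fin 2) (Fin 2) ℂ :=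
  Smat (φ 0) * ((List.range d).map (fun k => Wmat a * Smat (φ (k + 1)))).prod

namespace QSPProof

lemma qspSeq_zero (φ : ℕ → ℝ) (a : ℝ) : qspSeq 0 φ a = Smat (φ 0) := by
  simp [qspSeq]

lemma qspSeq_succ (d : ℕ) (φ : ℕ → ℝ) (a : ℝ) :
    qspSeq (d + 1) φ a = qspSeq d φ a * (Wmat a * Smat (φ (d + 1))) := by
  simp [qspSeq, List.range_succ, Matrix.mul_assoc]

lemma qspSeq_congr (d : ℕ) (φ ψ : ℕ → ℝ) (a : ℝ) (h : ∀ k ≤ d, φ k = ψ k) :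
    qspSeq d φ a = qspSeq d ψ a := by
  induction d with
  | zero => simp [qspSeq_zero, h 0 le_rfl]
  | succ d ih =>
    rw [qspSeq_succ, qspSeq_succ, ih (fun k hk => h k (by omega)), h (d + 1) le_rfl]

lemma exp_pos_form (x : ℝ) :
    Complex.exp (Complex.I * x) = (Real.cos x : ℂ) + Complex.I * (Real.sin x : ℂ) := by
  rw [mul_comm, Complex.exp_mul_I, Complex.ofReal_cos, Complex.ofReal_sin]; ring

lemma exp_neg_form (x : ℝ) :
    Complex.exp (-(Complex.I * x)) = (Real.cos x : ℂ) - Complex.I * (Real.sin x : ℂ) := by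
  have : -(Complex.I * (x : ℂ)) = (-(x : ℂ)) * Complex.I := by ring
  rw [this, Complex.exp_mul_I, Complex.cos_neg, Complex.sin_neg,
    Complex.ofReal_cos, Complex.ofReal_sin]; ring

/-- Structure of the QSP unitary. -/
lemma forward_struct (φ : ℕ → ℝ) (d : ℕ) : ∃ A B C' D : ℝ[X],
    A.natDegree ≤ d ∧ B.natDegree ≤ d ∧
    ((1 - X ^ 2) * C').natDegree ≤ d + 1 ∧ ((1 - X ^ 2) * D).natDegree ≤ d + 1 ∧
    (∀ x, A.eval (-x) = (-1) ^ d * A.eval x) ∧ (∀ x, B.eval (-x) = (-1) ^ d * B.eval x) ∧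
    (∀ x, C'.eval (-x) = -(-1) ^ d * C'.eval x) ∧ (∀ x, D.eval (-x) = -(-1) ^ d * D.eval x) ∧
    (∀ x, A.eval x ^ 2 + B.eval x ^ 2 + (1 - x ^ 2) * (C'.eval x ^ 2 + D.eval x ^ 2) = 1) ∧
    ∀ a ∈ Set.Icc (-1 : ℝ) 1,
      qspSeq d φ a 0 0 = A.eval a + Complex.I * B.eval a ∧
      qspSeq d φ a 0 1 = Complex.I * Real.sqrt (1 - a ^ 2) * (C'.eval a + Complex.I * D.eval a) ∧
      qspSeq d φ a 1 0 = Complex.I * Real.sqrt (1 - a ^ 2) * (C'.eval a - Complex.I * D.eval a) ∧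
      qspSeq d φ a 1 1 = A.eval a - Complex.I * B.eval a := by
  induction d with
  | zero =>
    refine ⟨C (Real.cos (φ 0)), C (Real.sin (φ 0)), 0, 0, by simp, by simp, by simp, by simp,
      by simp, by simp, by simp, by simp, by simp, ?_⟩
    intro a _
    rw [qspSeq_zero]
    simp only [Smat, exp_pos_form, exp_neg_form]
    simp
  | succ d ih =>
    obtain ⟨A, B, C', D, hA, hB, hC, hD, pA, pB, pC, pD, hn, hM⟩ := ih
    set c := Real.cos (φ (d + 1)) with hc
    set s := Real.sin (φ (d + 1)) with hs
    have hcs : c ^ 2 + s ^ 2 = 1 := Real.cos_sq_add_sin_sq _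
    have h1 : (X * A - (1 - X ^ 2) * C').natDegree ≤ d + 1 := by
      refine (natDegree_sub_le _ _).trans (max_le ?_ hC)
      exact natDegree_mul_le.trans (by rw [natDegree_X]; omega)
    have h2 : (X * B - (1 - X ^ 2) * D).natDegree ≤ d + 1 := by
      refine (natDegree_sub_le _ _).trans (max_le ?_ hD)
      exact natDegree_mul_le.trans (by rw [natDegree_X]; omega)
    have h0 : ((1 : ℝ[X]) - X ^ 2).natDegree ≤ 2 := by compute_degree
    have h3 : ((1 - X ^ 2) * A + X * ((1 - X ^ 2) * C')).natDegree ≤ d + 2 := by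
      refine (natDegree_add_le _ _).trans (max_le ?_ ?_)
      · exact natDegree_mul_le.trans (by omega)
      · exact natDegree_mul_le.trans (by rw [natDegree_X]; omega)
    have h4 : ((1 - X ^ 2) * B + X * ((1 - X ^ 2) * D)).natDegree ≤ d + 2 := by
      refine (natDegree_add_le _ _).trans (max_le ?_ ?_)
      · exact natDegree_mul_le.trans (by omega)
      · exact natDegree_mul_le.trans (by rw [natDegree_X]; omega)
    have key : ∀ (n : ℕ) (x y : ℝ) (p q : ℝ[X]), p.natDegree ≤ n → q.natDegree ≤ n →
        (C x * p + C y * q).natDegree ≤ n := by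
      intro n x y p q hp hq
      exact (natDegree_add_le _ _).trans (max_le ((natDegree_C_mul_le _ _).trans hp)
        ((natDegree_C_mul_le _ _).trans hq))
    refine ⟨C c * (X * A - (1 - X ^ 2) * C') + C (-s) * (X * B - (1 - X ^ 2) * D),
      C s * (X * A - (1 - X ^ 2) * C') + C c * (X * B - (1 - X ^ 2) * D),
      C c * (A + X * C') + C s * (B + X * D),
      C (-s) * (A + X * C') + C c * (B + X * D), key _ _ _ _ _ h1 h2, key _ _ _ _ _ h1 h2,
      ?_, ?_, ?_, ?_, ?_, ?_, ?_, ?_⟩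
    · convert key _ c s _ _ h3 h4 using 2
      ring
    · convert key _ (-s) c _ _ h3 h4 using 2
      ring
    · intro x; simp [pA, pB, pC, pD]; ring
    · intro x; simp [pA, pB, pC, pD]; ring
    · intro x; simp [pA, pB, pC, pD]; ring
    · intro x; simp [pA, pB, pC, pD]; ring
    · intro x
      have := hn x
      simp only [eval_add, eval_mul, eval_sub, eval_C, eval_X, eval_one, eval_pow]
      linear_combination (c ^ 2 + s ^ 2) * this + hcs
    · intro a ha
      obtain ⟨e1, e2, e3, e4⟩ := hM a ha
      have hr : ((Real.sqrt (1 - a ^ 2) : ℝ) : ℂ) ^ 2 = 1 - (a : ℂ) ^ 2 := by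
        rw [← Complex.ofReal_pow, Real.sq_sqrt (by nlinarith [ha.1, ha.2])]; push_cast; rfl
      set r : ℂ := ((Real.sqrt (1 - a ^ 2) : ℝ) : ℂ) with hrdef
      have hI : Complex.I ^ 2 = -1 := Complex.I_sq
      rw [qspSeq_succ]
      simp only [Matrix.mul_apply, Fin.sum_univ_two, e1, e2, e3, e4, Wmat, Smat, exp_pos_form,
        exp_neg_form, ← hc, ← hs, ← hrdef]
      simp only [eval_add, eval_mul, eval_sub, eval_C, eval_X, eval_one, eval_pow,
        Matrix.of_apply, Matrix.cons_val', Matrix.cons_val_zero, Matrix.cons_val_one,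
        Matrix.cons_val_fin_one, mul_zero, add_zero, zero_add]
      push_cast
      generalize ((eval a A : ℝ) : ℂ) = A at *
      generalize ((eval a B : ℝ) : ℂ) = B at *
      generalize ((eval a C' : ℝ) : ℂ) = C' at *
      generalize ((eval a D : ℝ) : ℂ) = D at *
      generalize (c : ℂ) = c at *
      generalize (s : ℂ) = s at *
      generalize (a : ℂ) = a at *
      generalize Complex.I = I at *
      clear_value r
      refine ⟨?_, ?_, ?_, ?_⟩ <;> grind

      
lemma forward (d : ℕ) (P : ℝ[X]) (φ : ℕ → ℝ)
    (h : ∀ a : ℝ, a ∈ Set.Icc (-1 : ℝ) 1 →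
        (1 / 2 : ℂ) * (qspSeq d φ a 0 0 + qspSeq d φ a 0 1 +
          qspSeq d φ a 1 0 + qspSeq d φ a 1 1) = ((P.eval a : ℝ) : ℂ)) :
    P.degree ≤ (d : ℕ) ∧
       P.comp (-X) = (-1) ^ d * P ∧
       (∀ a : ℝ, a ∈ Set.Icc (-1 : ℝ) 1 → |P.eval a| ≤ 1) := by
  obtain ⟨A, B, C', D, hA, hB, hC, hD, pA, pB, pC, pD, hn, hM⟩ := forward_struct φ d
  have hPA : ∀ a ∈ Set.Icc (-1 : ℝ) 1, P.eval a = A.eval a := by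
    intro a ha
    have h1 := h a ha
    obtain ⟨e1, e2, e3, e4⟩ := hM a ha
    rw [e1, e2, e3, e4] at h1
    have := congrArg Complex.re h1
    simp at this
    linarith
  have hP : P = A := by
    refine Polynomial.eq_of_infinite_eval_eq _ _ ?_
    exact (Set.Icc_infinite (by norm_num : (-1 : ℝ) < 1)).mono hPA
  subst hP
  refine ⟨natDegree_le_iff_degree_le.mp hA, ?_, ?_⟩
  · refine Polynomial.funext fun x => ?_
    simp [pA]
  · intro a ha
    have := hn a
    rw [abs_le_one_iff_mul_self_le_one]
    have h1 : 0 ≤ 1 - a ^ 2 := by nlinarith [ha.1, ha.2]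
    nlinarith [sq_nonneg (eval a B), mul_nonneg h1 (sq_nonneg (eval a C')),
      mul_nonneg h1 (sq_nonneg (eval a D))]

lemma polar (p q : ℝ) : ∃ x r : ℝ, 0 ≤ r ∧ p = r * Real.cos x ∧ q = r * Real.sin x := by
  refine ⟨Complex.arg ⟨p, q⟩, ‖(⟨p, q⟩ : ℂ)‖, norm_nonneg _, ?_, ?_⟩
  · rw [Complex.norm_mul_cos_arg]
  · rw [Complex.norm_mul_sin_arg]

/-- Completion: solving for phases. -/
lemma complete (d : ℕ) : ∀ f g : ℝ[X], f.natDegree ≤ d → g.natDegree ≤ d →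
    (∀ w : ℝ, 0 < w → f.eval w * f.eval w⁻¹ + g.eval w * g.eval w⁻¹ = 1) →
    ∃ φ : ℕ → ℝ, ∀ θ ∈ Set.Icc 0 Real.pi, ∀ u v : ℂ, 
      u = Real.cos θ + Complex.I * Real.sin θ → v = Real.cos θ - Complex.I * Real.sin θ →
      (qspSeq d φ (Real.cos θ) 0 0 + qspSeq d φ (Real.cos θ) 1 0 +
        (qspSeq d φ (Real.cos θ) 0 1 + qspSeq d φ (Real.cos θ) 1 1)
        = 2 * v ^ d * aeval (u ^ 2) f) ∧
      (qspSeq d φ (Real.cos θ) 0 0 + qspSeq d φ (Real.cos θ) 1 0 -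
        (qspSeq d φ (Real.cos θ) 0 1 + qspSeq d φ (Real.cos θ) 1 1)
        = 2 * Complex.I * v ^ d * aeval (u ^ 2) g) := by
  induction d with
  | zero =>
    intro f g hf hg h
    rw [Nat.le_zero, natDegree_eq_zero] at hf hg
    obtain ⟨p, rfl⟩ := hf
    obtain ⟨q, rfl⟩ := hg
    have h1 := h 1 one_pos
    simp only [eval_C] at h1
    obtain ⟨x, r, hr, hp, hq⟩ := polar p q
    have hr1 : r = 1 := by
      have := Real.cos_sq_add_sin_sq x
      have h2 : r ^ 2 = 1 := by
        rw [hp, hq] at h1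
        linear_combination h1 - r ^ 2 * this
      nlinarith
    subst hr1
    refine ⟨fun _ => x, fun θ _ u v _ _ => ?_⟩
    rw [qspSeq_zero]
    simp only [Smat, exp_pos_form, exp_neg_form, hp, hq]
    simp
    constructor <;> ring
  | succ d ih =>
    intro f g hf hg h
    -- orthogonality
    have horth : f.coeff 0 * f.coeff (d + 1) + g.coeff 0 * g.coeff (d + 1) = 0 := by
      have hpoly : f * reflect (d + 1) f + g * reflect (d + 1) g = X ^ (d + 1) := by
        refine Polynomial.eq_of_infinite_eval_eq _ _ ((Set.Ioi_infinite (0 : ℝ)).mono ?_)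
        intro w hw
        have hw : 0 < w := hw
        have hw0 : w⁻¹ ≠ 0 := (inv_pos.mpr hw).ne'
        let _ := invertibleOfNonzero hw0
        have e1 := eval₂_reflect_mul_pow (RingHom.id ℝ) w⁻¹ (d + 1) f hf
        have e2 := eval₂_reflect_mul_pow (RingHom.id ℝ) w⁻¹ (d + 1) g hg
        simp only [invOf_eq_inv, inv_inv, eval₂_id] at e1 e2
        have hh := h w hw
        rw [← e1, ← e2, inv_pow] at hh
        simp only [Set.mem_ofPred_eq, eval_add, eval_mul, eval_pow, eval_X]
        field_simp at hh
        linarith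
      have := congrArg (fun p => coeff p 0) hpoly
      simpa [coeff_reflect, revAt_le (Nat.zero_le (d + 1))] using this
    have hrot : ∃ x : ℝ, Real.cos x * f.coeff 0 + Real.sin x * g.coeff 0 = 0 ∧
        Real.cos x * g.coeff (d + 1) - Real.sin x * f.coeff (d + 1) = 0 := by
      obtain ⟨x, r, hr, hp, hq⟩ := polar (f.coeff (d + 1)) (g.coeff (d + 1))
      rcases eq_or_ne r 0 with h0 | h0
      · obtain ⟨y, t, ht, hp', hq'⟩ := polar (g.coeff 0) (-f.coeff 0)
        refine ⟨y, ?_, ?_⟩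
        · linear_combination -Real.cos y * hq' + Real.sin y * hp'
        · rw [hp, hq, h0]; ring
      · refine ⟨x, ?_, ?_⟩
        · apply mul_left_cancel₀ h0
          rw [hp, hq] at horth
          linear_combination horth
        · rw [hp, hq]; ring
    obtain ⟨x, hx0, hx1⟩ := hrot
    have hcs : Real.cos x ^ 2 + Real.sin x ^ 2 = 1 := Real.cos_sq_add_sin_sq _
    set c := Real.cos x with hc
    set s := Real.sin x with hs
    set f' := divX (C c * f + C s * g) with hf'
    set g' := C c * g - C s * f with hg'
    have hXf : X * f' = C c * f + C s * g := by
      have := divX_mul_X_add (C c * f + C s * g)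
      have h0 : (C c * f + C s * g).coeff 0 = 0 := by simpa using hx0
      rw [h0] at this
      simpa [mul_comm X] using this
    have df : f'.natDegree ≤ d := by
      rw [hf', natDegree_divX_eq_natDegree_tsub_one]
      have := natDegree_add_le_of_degree_le ((natDegree_C_mul_le c f).trans hf)
        ((natDegree_C_mul_le s g).trans hg)
      omega
    have dg : g'.natDegree ≤ d := by
      have := natDegree_sub_le_of_le ((natDegree_C_mul_le c g).trans hg)
        ((natDegree_C_mul_le s f).trans hf)
      rw [max_self] at this
      rw [natDegree_le_iff_coeff_eq_zero]
      intro N hN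
      rcases Nat.lt_or_ge (d + 1) N with h1 | h1
      · exact coeff_eq_zero_of_natDegree_lt (lt_of_le_of_lt this h1)
      · obtain rfl : N = d + 1 := by omega
        simpa [hg'] using hx1
    have hev : ∀ w, w * f'.eval w = c * f.eval w + s * g.eval w := by
      intro w
      have := congrArg (eval w) hXf
      simpa using this
    have heg : ∀ w, g'.eval w = c * g.eval w - s * f.eval w := by
      intro w; simp [hg']
    obtain ⟨φ, hφ⟩ := ih f' g' df dg (by
      intro w hw
      have h1 := hev w
      have h2 := hev w⁻¹
      have h3 : eval w f' * eval w⁻¹ f' = (w * eval w f') * (w⁻¹ * eval w⁻¹ f') := by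
        field_simp
      rw [h3, h1, h2, heg, heg]
      linear_combination (c ^ 2 + s ^ 2) * h w hw + hcs)
    refine ⟨fun k => if k ≤ d then φ k else x, ?_⟩
    intro θ hθ u v hu hv
    have hφ' := hφ θ hθ u v hu hv
    rw [qspSeq_succ, qspSeq_congr d _ φ _ (fun k hk => by simp [hk])]
    have hsq : Real.sqrt (1 - Real.cos θ ^ 2) = Real.sin θ := by
      rw [← Real.sin_sq, Real.sqrt_sq (Real.sin_nonneg_of_mem_Icc hθ)]
    have huv : u * v = 1 := by
      have h1 := Real.cos_sq_add_sin_sq θ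
      have : ((Real.cos θ : ℝ) : ℂ) ^ 2 + ((Real.sin θ : ℝ) : ℂ) ^ 2 = 1 := by
        exact_mod_cast h1
      rw [hu, hv]
      linear_combination this - ((Real.sin θ : ℝ) : ℂ) ^ 2 * Complex.I_sq
    have hXf' : u ^ 2 * aeval (u ^ 2) f' = c * aeval (u ^ 2) f + s * aeval (u ^ 2) g := by
      have := congrArg (aeval (u ^ 2)) hXf
      simpa using this
    have hg'' : aeval (u ^ 2) g' = c * aeval (u ^ 2) g - s * aeval (u ^ 2) f := by
      simp [hg']
    have hcs' : (c : ℂ) ^ 2 + (s : ℂ) ^ 2 = 1 := by exact_mod_cast hcs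
    obtain ⟨hp, hm⟩ := hφ'
    generalize qspSeq d φ (Real.cos θ) = M at *
    simp only [Matrix.mul_apply, Fin.sum_univ_two, Wmat, Smat, hsq]
    simp only [
        Matrix.of_apply, Matrix.cons_val', Matrix.cons_val_zero, Matrix.cons_val_one,
        Matrix.cons_val_fin_one, mul_zero, add_zero, zero_add]
    rw [if_neg (by omega), exp_pos_form, exp_neg_form, ← hc, ← hs]
    generalize (aeval (u ^ 2)) f = F at *
    generalize (aeval (u ^ 2)) g = G at *
    generalize (aeval (u ^ 2)) f' = F' at *
    generalize (aeval (u ^ 2)) g' = G' at *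
    have hI : Complex.I ^ 2 = -1 := Complex.I_sq
    generalize (c : ℂ) = c at *
    generalize (s : ℂ) = s at *
    generalize hct : ((Real.cos θ : ℝ) : ℂ) = ct at *
    generalize hst : ((Real.sin θ : ℝ) : ℂ) = st at *
    generalize M 0 0 = m00 at *
    generalize M 0 1 = m01 at *
    generalize M 1 0 = m10 at *
    generalize M 1 1 = m11 at *
    generalize Complex.I = I at *
    have hF : F = c * (u ^ 2 * F') - s * G' := by
      rw [hXf', hg'']; linear_combination -F * hcs'
    have hG : G = c * G' + s * (u ^ 2 * F') := by
      rw [hXf', hg'']; linear_combination -G * hcs'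
    have hp2 : (m00 + m10 + (m01 + m11)) * u = 2 * (v ^ (d + 1)) * (u ^ 2 * F') := by
      rw [hp, pow_succ]; linear_combination (-2 * v ^ d * F' * u) * huv
    have hm2 : (m00 + m10 - (m01 + m11)) * v = 2 * I * v ^ (d + 1) * G' := by
      rw [hm, pow_succ]; ring
    rw [hF, hG]
    have hP : (m00 + m10) * ct + (m01 + m11) * (I * st) + ((m00 + m10) * (I * st) + (m01 + m11) * ct)
        = 2 * (v ^ (d + 1)) * (u ^ 2 * F') := by
      rw [← hp2, hu]; ring
    have hQ : (m00 + m10) * ct + (m01 + m11) * (I * st) - ((m00 + m10) * (I * st) + (m01 + m11) * ct)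
        = 2 * I * v ^ (d + 1) * G' := by
      rw [← hm2, hv]; ring
    constructor
    · linear_combination c * hP + I * s * hQ + 2 * s * v ^ (d + 1) * G' * hI
    · linear_combination c * hQ + I * s * hP

/-- Dividing out a nonnegative factor preserves nonnegativity on an interval. -/
lemma nonneg_of_mul (a b : ℝ) (hab : a < b) (q K : ℝ[X]) (hq : q ≠ 0)
    (hq0 : ∀ t ∈ Set.Icc a b, 0 ≤ q.eval t) (h : ∀ t ∈ Set.Icc a b, 0 ≤ (q * K).eval t) :
    ∀ t ∈ Set.Icc a b, 0 ≤ K.eval t := by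
  have hcl : Set.Icc a b ⊆ closure (Set.Ioo a b \ {t | q.IsRoot t}) := by
    have hfin : {t | q.IsRoot t}.Finite := by
      refine (q.roots.toFinset.finite_toSet).subset ?_
      intro t ht
      simpa [hq] using ht
    have : Dense ({t | q.IsRoot t}ᶜ) := hfin.countable.dense_compl ℝ
    have h2 := this.open_subset_closure_inter (isOpen_Ioo (a := a) (b := b))
    rw [← closure_Ioo hab.ne]
    refine closure_minimal ?_ isClosed_closure
    rwa [Set.sdiff_eq]
  have hclosed : IsClosed {t : ℝ | 0 ≤ K.eval t} := isClosed_le continuous_const K.continuous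
  intro t ht
  refine closure_minimal ?_ hclosed (hcl ht)
  rintro x ⟨hx, hx'⟩
  have hx1 := Set.Ioo_subset_Icc_self hx
  have h1 := hq0 x hx1
  have h2 := h x hx1
  have h3 : q.eval x ≠ 0 := hx'
  rw [eval_mul] at h2
  have h4 : 0 < q.eval x := lt_of_le_of_ne h1 h3.symm
  exact nonneg_of_mul_nonneg_right h2 h4

/-- `K` admits a spectral factor of degree at most `n`. -/
def Rep (n : ℕ) (K : ℝ[X]) : Prop :=
  ∃ g : ℝ[X], g.natDegree ≤ n ∧
    ∀ w : ℝ, 0 < w → g.eval w * g.eval w⁻¹ = K.eval ((2 + w + w⁻¹) / 4)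

lemma Rep.mul {m n : ℕ} {K L : ℝ[X]} (hK : Rep m K) (hL : Rep n L) : Rep (m + n) (K * L) := by
  obtain ⟨g, hg, hgw⟩ := hK
  obtain ⟨k, hk, hkw⟩ := hL
  refine ⟨g * k, natDegree_mul_le.trans (by omega), fun w hw => ?_⟩
  rw [eval_mul, eval_mul, eval_mul, ← hgw w hw, ← hkw w hw]; ring

lemma Rep.mono {m n : ℕ} {K : ℝ[X]} (hK : Rep m K) (h : m ≤ n) : Rep n K := by
  obtain ⟨g, hg, hgw⟩ := hK
  exact ⟨g, hg.trans h, hgw⟩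

lemma rep_const (c : ℝ) (hc : 0 ≤ c) : Rep 0 (C c) :=
  ⟨C (Real.sqrt c), by simp, fun w _ => by simp [Real.mul_self_sqrt hc]⟩

lemma rep_left (r : ℝ) (hr : r ≤ 0) : Rep 1 (X - C r) := by
  refine ⟨C ((√(1 - r) + √(-r)) / 2) + C ((√(1 - r) - √(-r)) / 2) * X, by compute_degree,
    fun w hw => ?_⟩
  have h1 := Real.mul_self_sqrt (show 0 ≤ 1 - r by linarith)
  have h2 := Real.mul_self_sqrt (show 0 ≤ -r by linarith)
  simp only [eval_add, eval_C, eval_mul, eval_X, eval_sub]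
  have hw1 : w * w⁻¹ = 1 := mul_inv_cancel₀ hw.ne'
  generalize √(1 - r) = p at *
  generalize √(-r) = q at *
  generalize w⁻¹ = v at *
  linear_combination ((1 + w * v + w + v) * h1 + (1 + w * v - w - v) * h2) / 4 + (1 - 2 * r) / 4 * hw1
    - p * q / 2 * hw1

lemma rep_right (r : ℝ) (hr : 1 ≤ r) : Rep 1 (C r - X) := by
  refine ⟨C ((√r + √(r - 1)) / 2) + C ((√(r - 1) - √r) / 2) * X, by compute_degree,
    fun w hw => ?_⟩
  have h1 := Real.mul_self_sqrt (show 0 ≤ r by linarith)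
  have h2 := Real.mul_self_sqrt (show 0 ≤ r - 1 by linarith)
  simp only [eval_add, eval_C, eval_mul, eval_X, eval_sub]
  have hw1 : w * w⁻¹ = 1 := mul_inv_cancel₀ hw.ne'
  generalize √r = p at *
  generalize √(r - 1) = q at *
  generalize w⁻¹ = v at *
  linear_combination ((1 + w * v - w - v) * h1 + (1 + w * v + w + v) * h2) / 4
    + (2 * r - 1) / 4 * hw1 - p * q / 2 * hw1

lemma rep_quad (ζ : ℂ) : Rep 2 (X ^ 2 - C (2 * ζ.re) * X + C (‖ζ‖ ^ 2)) := by
  obtain ⟨ρ, hρ⟩ : ∃ ρ : ℂ, 1 * (ρ * ρ) + (-(4 * ζ - 2)) * ρ + 1 = 0 := by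
    refine exists_quadratic_eq_zero one_ne_zero ?_
    obtain ⟨s, hs⟩ := IsAlgClosed.exists_eq_mul_self (discrim 1 (-(4 * ζ - 2)) 1)
    exact ⟨s, hs⟩
  have hρ0 : ρ ≠ 0 := by
    rintro rfl
    simp at hρ
  have hn : ‖ρ‖ ≠ 0 := norm_ne_zero_iff.mpr hρ0
  refine ⟨C (1 / (4 * ‖ρ‖)) * (X ^ 2 - C (2 * ρ.re) * X + C (‖ρ‖ ^ 2)), ?_, fun w hw => ?_⟩
  · refine (natDegree_C_mul_le _ _).trans ?_
    compute_degree
  have hq : ∀ (z : ℂ) (t : ℝ), t ^ 2 - 2 * z.re * t + ‖z‖ ^ 2 = Complex.normSq ((t : ℂ) - z) := by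
    intro z t
    rw [← Complex.normSq_eq_norm_sq, Complex.normSq_apply, Complex.normSq_apply]
    simp; ring
  simp only [eval_add, eval_C, eval_mul, eval_X, eval_sub, eval_pow]
  rw [hq, hq, hq]
  have hw1 : (w : ℂ) * (w⁻¹ : ℝ) = 1 := by
    rw [← Complex.ofReal_mul, mul_inv_cancel₀ hw.ne']; simp
  have key : ((w : ℂ) - ρ) * (((w⁻¹ : ℝ) : ℂ) - ρ)
      = (-4 * ρ) * ((((2 + w + w⁻¹) / 4 : ℝ) : ℂ) - ζ) := by
    push_cast at hw1 ⊢
    linear_combination hw1 + hρ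
  have key2 := congrArg Complex.normSq key
  rw [Complex.normSq_mul, Complex.normSq_mul, Complex.normSq_mul] at key2
  have h16 : Complex.normSq (-4 : ℂ) = 16 := by
    rw [Complex.normSq_apply]; norm_num
  rw [h16, Complex.normSq_eq_norm_sq ρ] at key2
  generalize Complex.normSq ((((2 + w + w⁻¹) / 4 : ℝ) : ℂ) - ζ) = n1 at *
  generalize Complex.normSq (((w⁻¹ : ℝ) : ℂ) - ρ) = n2 at *
  field_simp
  linear_combination key2

lemma spectral (n : ℕ) : ∀ K : ℝ[X], K.natDegree ≤ n →
    (∀ t ∈ Set.Icc (0 : ℝ) 1, 0 ≤ K.eval t) → Rep n K := by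
  induction n using Nat.strong_induction_on with
  | _ n ih =>
  intro K hK hpos
  rcases Nat.eq_zero_or_pos K.natDegree with h0 | h0
  · obtain ⟨c, rfl⟩ := natDegree_eq_zero.mp h0
    exact (rep_const c (by simpa using hpos 0 (by simp))).mono (Nat.zero_le _)
  -- peel off a factor
  have peel : ∀ (m : ℕ) (q L : ℝ[X]), 0 < m → q.natDegree = m → K = q * L →
      (∀ t ∈ Set.Icc (0 : ℝ) 1, 0 ≤ q.eval t) → Rep m q → Rep n K := by
    intro m q L hm hqm hKq hq0 hrep
    have hK0 : K ≠ 0 := by rintro rfl; simp at h0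
    have hq : q ≠ 0 := by rintro rfl; simp at hqm; omega
    have hL : L ≠ 0 := by rintro rfl; simp at hKq; exact hK0 hKq
    have hdeg : K.natDegree = m + L.natDegree := by rw [hKq, natDegree_mul hq hL, hqm]
    have hLpos := nonneg_of_mul 0 1 one_pos q L hq hq0 (by rw [← hKq]; exact hpos)
    have := hrep.mul (ih (n - m) (by omega) L (by omega) hLpos)
    rw [hKq]
    exact this.mono (by omega)
  have hquad : ∀ ζ : ℂ, (X ^ 2 - C (2 * ζ.re) * X + C (‖ζ‖ ^ 2)) ∣ K → Rep n K := by
    rintro ζ ⟨L, hL⟩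
    refine peel 2 _ L (by norm_num) (by compute_degree!) hL ?_ (rep_quad ζ)
    intro t _
    have : ‖ζ‖ ^ 2 = ζ.re ^ 2 + ζ.im ^ 2 := by
      rw [← Complex.normSq_eq_norm_sq, Complex.normSq_apply]; ring
    simp [this]
    nlinarith [sq_nonneg (t - ζ.re), sq_nonneg ζ.im]
  obtain ⟨ζ, hζ⟩ : ∃ ζ : ℂ, aeval ζ K = 0 := by
    refine IsAlgClosed.exists_aeval_eq_zero ℂ K ?_
    rw [degree_eq_natDegree (by rintro rfl; simp at h0)]
    exact_mod_cast h0.ne'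
  by_cases him : ζ.im = 0
  · obtain ⟨r, rfl⟩ : ∃ r : ℝ, ζ = r := ⟨ζ.re, Complex.ext rfl (by simpa using him)⟩
    have hr : K.IsRoot r := by
      have : ((K.eval r : ℝ) : ℂ) = 0 := by
        rw [← hζ]
        simpa using (aeval_algebraMap_apply ℂ r K).symm
      exact_mod_cast this
    obtain ⟨L, hL⟩ := dvd_iff_isRoot.mpr hr
    rcases le_or_gt r 0 with h1 | h1
    · exact peel 1 _ L one_pos (natDegree_X_sub_C r) hL
        (fun t ht => by simp; linarith [ht.1]) (rep_left r h1)
    rcases le_or_gt 1 r with h2 | h2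
    · refine peel 1 (C r - X) (-L) one_pos ?_ (by rw [hL]; ring)
        (fun t ht => by simp; linarith [ht.2]) (rep_right r h2)
      compute_degree!
    · have hLr : L.IsRoot r := by
        have e1 := nonneg_of_mul r 1 h2 (X - C r) L (X_sub_C_ne_zero r)
          (fun t ht => by simp; linarith [ht.1])
          (fun t ht => by rw [← hL]; exact hpos t ⟨by linarith [ht.1], ht.2⟩) r ⟨le_rfl, h2.le⟩
        have e2 := nonneg_of_mul 0 r h1 (-(X - C r)) (-L) (neg_ne_zero.mpr (X_sub_C_ne_zero r))
          (fun t ht => by simp; linarith [ht.2])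
          (fun t ht => by rw [neg_mul_neg, ← hL]; exact hpos t ⟨ht.1, by linarith [ht.2]⟩)
          r ⟨h1.le, le_rfl⟩
        rw [eval_neg] at e2
        exact le_antisymm (by linarith) e1
      obtain ⟨L', hL'⟩ := dvd_iff_isRoot.mpr hLr
      refine hquad (r : ℂ) ⟨L', ?_⟩
      rw [hL, hL']
      have hC2 : (C 2 : ℝ[X]) = 2 := rfl
      simp [hC2]
      ring
  · exact hquad ζ (quadratic_dvd_of_aeval_eq_zero_im_ne_zero K hζ him)

/-- Parity of coefficients. -/
lemma coeff_parity (d : ℕ) (P : ℝ[X]) (h : P.comp (-X) = (-1) ^ d * P) (k : ℕ)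
    (hk : (d + k) % 2 = 1) : P.coeff k = 0 := by
  have h1 := congrArg (fun p => coeff p k) h
  have h2 : ((-1 : ℝ[X]) ^ d) = C ((-1) ^ d) := by simp
  simp only [h2, coeff_C_mul] at h1
  have h3 : (P.comp (-X)).coeff k = (-1) ^ k * P.coeff k := by
    have : (-X : ℝ[X]) = C (-1) * X := by simp
    rw [this, comp_C_mul_X_coeff]; ring
  rw [h3] at h1
  have h4 : ((-1 : ℝ) ^ d) * (-1) ^ k = -1 := by
    rw [← pow_add]; exact Odd.neg_one_pow (Nat.odd_iff.mpr hk)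
  have h5 : ((-1 : ℝ) ^ d) * (-1) ^ d = 1 := by
    rw [← mul_pow]; simp
  have : (-1) ^ d * ((-1) ^ k * P.coeff k) = (-1) ^ d * ((-1) ^ d * P.coeff k) := by rw [h1]
  linear_combination (-1 / 2) * this + (P.coeff k) / 2 * h4 - P.coeff k / 2 * h5

/-- The even polynomial `1 - P²` is a polynomial in `x²`. -/
lemma exists_K (d : ℕ) (P : ℝ[X]) (hd : P.natDegree ≤ d) (h : P.comp (-X) = (-1) ^ d * P) :
    ∃ K : ℝ[X], K.natDegree ≤ d ∧ ∀ x, K.eval (x ^ 2) = 1 - P.eval x ^ 2 := by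
  set E : ℝ[X] := 1 - P ^ 2 with hE
  have hE0 : E.comp (-X) = (-1) ^ 0 * E := by
    rw [hE]
    simp only [sub_comp, one_comp, pow_comp, h, mul_pow]
    rw [← pow_mul, mul_comm d 2, pow_mul]; simp
  have hexp : expand ℝ 2 (contract 2 E) = E := by
    ext k
    rw [coeff_expand (by norm_num), coeff_contract (by norm_num)]
    split_ifs with h2
    · rw [Nat.div_mul_cancel h2]
    · exact (coeff_parity 0 E hE0 k (by omega)).symm
  refine ⟨contract 2 E, ?_, fun x => ?_⟩
  · have h1 : E.natDegree ≤ 2 * d := by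
      rw [hE]
      refine (natDegree_sub_le _ _).trans (max_le (by simp) ?_)
      exact natDegree_pow_le.trans (by gcongr)
    rw [← hexp, natDegree_expand] at h1
    omega
  · rw [← expand_eval, hexp, hE]; simp

/-- The polynomial `f` with `f(u²) = u^d P((u + u⁻¹)/2)`. -/
lemma exists_f (d : ℕ) (P : ℝ[X]) (hd : P.natDegree ≤ d) (h : P.comp (-X) = (-1) ^ d * P) :
    ∃ f : ℝ[X], f.natDegree ≤ d ∧
      (∀ u v : ℂ, u * v = 1 → v ^ d * aeval (u ^ 2) f = aeval ((u + v) / 2) P) := by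
  refine ⟨∑ k ∈ Finset.range (d + 1),
    C (P.coeff k) * (X ^ ((d - k) / 2) * (C (1 / 2) * (X + 1)) ^ k), ?_, ?_⟩
  · refine natDegree_sum_le_of_forall_le _ _ fun k hk => ?_
    have hk : k ≤ d := by simpa [Nat.lt_succ_iff] using hk
    refine (natDegree_C_mul_le _ _).trans (natDegree_mul_le.trans ?_)
    have h1 : ((C (1 / 2) * (X + 1) : ℝ[X]) ^ k).natDegree ≤ k * 1 := by
      refine natDegree_pow_le.trans ?_
      gcongr
      compute_degree
    rw [natDegree_X_pow]
    omega
  · intro u v huv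
    rw [aeval_eq_sum_range' (Nat.lt_succ_of_le hd), map_sum, Finset.mul_sum]
    refine Finset.sum_congr rfl fun k hk => ?_
    have hk : k ≤ d := by simpa [Nat.lt_succ_iff] using hk
    by_cases hp : (d + k) % 2 = 1
    · simp [coeff_parity d P h k hp]
    · obtain ⟨m, hm⟩ : ∃ m, d = k + 2 * m := ⟨(d - k) / 2, by omega⟩
      have hm' : (d - k) / 2 = m := by omega
      rw [hm', hm]
      simp only [map_mul, aeval_C, map_pow, aeval_X, map_add, map_one, Algebra.smul_def]
      have e1 : (v ^ 2 * u ^ 2) ^ m = 1 := by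
        rw [← mul_pow, mul_comm v u, huv]; simp
      have e2 : v * (algebraMap ℝ ℂ (1 / 2) * (u ^ 2 + 1)) = (u + v) / 2 := by
        have : algebraMap ℝ ℂ (1 / 2) = 1 / 2 := by simp
        rw [this]
        linear_combination u / 2 * huv
      rw [← e2, pow_add, pow_mul, mul_pow v]
      rw [mul_pow] at e1
      linear_combination (v ^ k * (algebraMap ℝ ℂ (P.coeff k)) *
        (algebraMap ℝ ℂ (1 / 2) * (u ^ 2 + 1)) ^ k) * e1

lemma backward (d : ℕ) (P : ℝ[X]) (hd : P.degree ≤ (d : ℕ)) (h : P.comp (-X) = (-1) ^ d * P)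
    (hb : ∀ a : ℝ, a ∈ Set.Icc (-1 : ℝ) 1 → |P.eval a| ≤ 1) :
    ∃ φ : ℕ → ℝ, ∀ a : ℝ, a ∈ Set.Icc (-1 : ℝ) 1 →
        (1 / 2 : ℂ) * (qspSeq d φ a 0 0 + qspSeq d φ a 0 1 +
          qspSeq d φ a 1 0 + qspSeq d φ a 1 1) = ((P.eval a : ℝ) : ℂ) := by
  have hd' : P.natDegree ≤ d := natDegree_le_iff_degree_le.mpr hd
  obtain ⟨K, hK, hKx⟩ := exists_K d P hd' h
  obtain ⟨f, hf, hfu⟩ := exists_f d P hd' h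
  have hcast : ∀ (p : ℝ[X]) (t : ℝ), aeval (t : ℂ) p = ((p.eval t : ℝ) : ℂ) := by
    intro p t
    simpa using (aeval_algebraMap_apply ℂ t p)
  have hfr : ∀ u v : ℝ, u * v = 1 → v ^ d * f.eval (u ^ 2) = P.eval ((u + v) / 2) := by
    intro u v huv
    have := hfu u v (by exact_mod_cast huv)
    have e1 : ((u : ℂ) ^ 2) = ((u ^ 2 : ℝ) : ℂ) := by push_cast; rfl
    have e2 : (((u : ℂ) + v) / 2) = (((u + v) / 2 : ℝ) : ℂ) := by push_cast; rfl
    rw [e1, e2, hcast, hcast] at this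
    exact_mod_cast this
  have hKpos : ∀ t ∈ Set.Icc (0 : ℝ) 1, 0 ≤ K.eval t := by
    intro t ht
    have h1 := hKx (√t)
    rw [Real.sq_sqrt ht.1] at h1
    have h2 := hb (√t) ⟨by linarith [Real.sqrt_nonneg t], Real.sqrt_le_one.mpr ht.2⟩
    have h3 := (sq_le_one_iff_abs_le_one _).mpr h2
    linarith
  obtain ⟨g, hg, hgw⟩ := spectral d K hK hKpos
  obtain ⟨φ, hφ⟩ := complete d f g hf hg (by
    intro w hw
    have hu : 0 < √w := Real.sqrt_pos.mpr hw
    have huv : √w * (√w)⁻¹ = 1 := mul_inv_cancel₀ hu.ne'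
    have h1 := hfr (√w) (√w)⁻¹ huv
    have h2 := hfr (√w)⁻¹ (√w) (by rw [mul_comm]; exact huv)
    rw [inv_pow, Real.sq_sqrt hw.le] at h2
    rw [Real.sq_sqrt hw.le] at h1
    have h3 := hKx ((√w + (√w)⁻¹) / 2)
    have h4 : ((√w + (√w)⁻¹) / 2) ^ 2 = (2 + w + w⁻¹) / 4 := by
      have e1 := Real.sq_sqrt hw.le
      have e2 : (√w)⁻¹ ^ 2 = w⁻¹ := by rw [inv_pow, e1]
      linear_combination e1 / 4 + e2 / 4 + huv / 2
    rw [h4, ← hgw w hw] at h3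
    have h5 : f.eval w * f.eval w⁻¹ = P.eval ((√w + (√w)⁻¹) / 2) ^ 2 := by
      rw [add_comm (√w)⁻¹] at h2
      have e3 : (√w) ^ d * ((√w)⁻¹) ^ d = 1 := by rw [← mul_pow, huv, one_pow]
      rw [sq]
      nth_rewrite 1 [← h1]
      rw [← h2]
      linear_combination (-(f.eval w * f.eval w⁻¹)) * e3
    linear_combination h5 + h3)
  refine ⟨φ, fun a ha => ?_⟩
  have hθ : Real.arccos a ∈ Set.Icc 0 Real.pi := ⟨Real.arccos_nonneg a, Real.arccos_le_pi a⟩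
  have hcos : Real.cos (Real.arccos a) = a := Real.cos_arccos ha.1 ha.2
  have h1 := (hφ _ hθ _ _ rfl rfl).1
  rw [hcos] at h1
  have hcs := Real.cos_sq_add_sin_sq (Real.arccos a)
  rw [hcos] at hcs
  have hcs' : (a : ℂ) ^ 2 + ((Real.sin (Real.arccos a) : ℝ) : ℂ) ^ 2 = 1 := by exact_mod_cast hcs
  generalize ((Real.sin (Real.arccos a) : ℝ) : ℂ) = s at *
  have h2 := hfu (a + Complex.I * s) (a - Complex.I * s)
    (by linear_combination hcs' - s ^ 2 * Complex.I_sq)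
  have h3 : ((a : ℂ) + Complex.I * s + (a - Complex.I * s)) / 2 = a := by ring
  rw [h3, hcast] at h2
  rw [mul_assoc, h2] at h1
  linear_combination h1 / 2

end QSPProof

/-- The `(W_x, S_z, ⟨+|·|+⟩)`-QSP characterization theorem. -/
theorem qsp_Wx_Sz_pp (d : ℕ) (P : Polynomial ℝ) :
    (∃ φ : ℕ → ℝ, ∀ a : ℝ, a ∈ Set.Icc (-1 : ℝ) 1 →
        (1 / 2 : ℂ) * (qspSeq d φ a 0 0 + qspSeq d φ a 0 1 +
          qspSeq d φ a 1 0 + qspSeq d φ a 1 1) = ((P.eval a : ℝ) : ℂ)) ↔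
      (P.degree ≤ (d : ℕ) ∧
       P.comp (-X) = (-1) ^ d * P ∧
       (∀ a : ℝ, a ∈ Set.Icc (-1 : ℝ) 1 → |P.eval a| ≤ 1)) := by
  exact ⟨fun ⟨φ, h⟩ => QSPProof.forward d P φ h,
    fun ⟨h1, h2, h3⟩ => QSPProof.backward d P h1 h2 h3⟩
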